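/- arXiv:1803.10538 — 2 statements merged into one kernel-verified Lean document; each statement's English description precedes it below -/
import Mathlib

section
/- Let n ≥ 2 and let G ⊆ ℝⁿ be a bounded subregion with Per(G) < ∞, and let L > Per(G). Then there is no volume-maximal subset of perimeter L: for every Lebesgue measurable E ⊆ cl(G) with Per(E) = L there exists a measurable E' ⊆ cl(G) with Per(E') = L and Lⁿ(E') > Lⁿ(E). -/
open MeasureTheory
open scoped ENNReal

/-- The divergence of a vector field on `ℝⁿ`. -/
noncomputable def vecDiv {n : ℕ} (φ : EuclideanSpace ℝ (Fin n) → EuclideanSpace ℝ (Fin n))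
    (x : EuclideanSpace ℝ (Fin n)) : ℝ :=
  ∑ i : Fin n, fderiv ℝ φ x (EuclideanSpace.single i 1) i

/-- The perimeter of a set `E` relative to an open set `F`:
`Per(E;F) = sup { ∫_E div φ dx : φ ∈ C¹_0(F, ℝⁿ), |φ| ≤ 1 }`. -/
noncomputable def perIn {n : ℕ} (E F : Set (EuclideanSpace ℝ (Fin n))) : ℝ≥0∞ :=
  ⨆ φ : {φ : EuclideanSpace ℝ (Fin n) → EuclideanSpace ℝ (Fin n) //
      ContDiff ℝ 1 φ ∧ HasCompactSupport φ ∧ tsupport φ ⊆ F ∧ ∀ x, ‖φ x‖ ≤ 1},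
    ENNReal.ofReal (∫ x in E, vecDiv φ.1 x)

/-- The perimeter of `E` (relative to all of `ℝⁿ`). -/
noncomputable def per {n : ℕ} (E : Set (EuclideanSpace ℝ (Fin n))) : ℝ≥0∞ :=
  perIn E Set.univ

section Perimeter

open Metric Set Filter Topology
open scoped Pointwise Manifold

variable {n : ℕ}

local notation "ℝⁿ" => EuclideanSpace ℝ (Fin n)

/-- The vector fields that compete in the definition of the perimeter. -/
structure IsTestField (φ : ℝⁿ → ℝⁿ) : Prop where
  contDiff : ContDiff ℝ 1 φ
  hasCompactSupport : HasCompactSupport φ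
  norm_le_one : ∀ x, ‖φ x‖ ≤ 1

theorem IsTestField.le_per {φ : ℝⁿ → ℝⁿ} (hφ : IsTestField φ) (E : Set ℝⁿ) :
    ENNReal.ofReal (∫ x in E, vecDiv φ x) ≤ per E :=
  le_iSup_of_le ⟨φ, hφ.1, hφ.2, subset_univ _, hφ.3⟩ le_rfl

theorem per_le_iff {E : Set ℝⁿ} {c : ℝ≥0∞} :
    per E ≤ c ↔ ∀ φ : ℝⁿ → ℝⁿ, IsTestField φ → ENNReal.ofReal (∫ x in E, vecDiv φ x) ≤ c :=
  ⟨fun h _ hφ => (hφ.le_per E).trans h, fun h => iSup_le fun φ => h φ.1 ⟨φ.2.1, φ.2.2.1, φ.2.2.2.2⟩⟩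

theorem per_congr_ae {E F : Set ℝⁿ} (h : E =ᵐ[volume] F) : per E = per F := by
  simp only [per, perIn, setIntegral_congr_set h]

theorem vecDiv_congr {φ ψ : ℝⁿ → ℝⁿ} {x : ℝⁿ} (h : φ =ᶠ[𝓝 x] ψ) : vecDiv φ x = vecDiv ψ x := by
  simp only [vecDiv, h.fderiv_eq]

theorem vecDiv_zero (x : ℝⁿ) : vecDiv (fun _ => 0 : ℝⁿ → ℝⁿ) x = 0 := by
  simp [vecDiv]

theorem vecDiv_add {φ ψ : ℝⁿ → ℝⁿ} (hφ : ContDiff ℝ 1 φ) (hψ : ContDiff ℝ 1 ψ) (x : ℝⁿ) :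
    vecDiv (fun y => φ y + ψ y) x = vecDiv φ x + vecDiv ψ x := by
  simp [vecDiv, fderiv_fun_add (hφ.differentiable one_ne_zero x)
    (hψ.differentiable one_ne_zero x), Finset.sum_add_distrib]

theorem vecDiv_neg (φ : ℝⁿ → ℝⁿ) (x : ℝⁿ) : vecDiv (fun y => -φ y) x = -vecDiv φ x := by
  simp [vecDiv, fderiv_fun_neg]

theorem vecDiv_eq_zero_of_notMem_tsupport {φ : ℝⁿ → ℝⁿ} {x : ℝⁿ} (hx : x ∉ tsupport φ) :
    vecDiv φ x = 0 := by
  rw [vecDiv_congr (notMem_tsupport_iff_eventuallyEq.1 hx)]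
  exact vecDiv_zero x

theorem IsTestField.zero : IsTestField (fun _ => 0 : ℝⁿ → ℝⁿ) :=
  ⟨contDiff_const, HasCompactSupport.zero, by simp⟩

theorem IsTestField.neg {φ : ℝⁿ → ℝⁿ} (hφ : IsTestField φ) : IsTestField (fun x => -φ x) :=
  ⟨hφ.1.neg, hφ.2.neg, by simpa using hφ.3⟩

theorem IsTestField.smul {φ : ℝⁿ → ℝⁿ} (hφ : IsTestField φ) {χ : ℝⁿ → ℝ} (hχ : ContDiff ℝ 1 χ)
    (h01 : ∀ x, χ x ∈ Icc 0 1) : IsTestField (fun x => χ x • φ x) := by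
  refine ⟨hχ.smul hφ.1, hφ.2.smul_left (f := χ), fun x => ?_⟩
  rw [norm_smul, Real.norm_of_nonneg (h01 x).1]
  exact mul_le_one₀ (h01 x).2 (norm_nonneg _) (hφ.3 x)

theorem continuous_vecDiv {φ : ℝⁿ → ℝⁿ} (hφ : ContDiff ℝ 1 φ) : Continuous (vecDiv φ) := by
  have := hφ.continuous_fderiv one_ne_zero
  unfold vecDiv
  fun_prop

theorem hasCompactSupport_vecDiv {φ : ℝⁿ → ℝⁿ} (hφ : HasCompactSupport φ) :
    HasCompactSupport (vecDiv φ) :=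
  HasCompactSupport.intro hφ fun _ hx => vecDiv_eq_zero_of_notMem_tsupport hx

theorem IsTestField.integrable {φ : ℝⁿ → ℝⁿ} (hφ : IsTestField φ) : Integrable (vecDiv φ) :=
  (continuous_vecDiv hφ.1).integrable_of_hasCompactSupport (hasCompactSupport_vecDiv hφ.2)

theorem integral_vecDiv_eq_zero {φ : ℝⁿ → ℝⁿ} (hφ : IsTestField φ) :
    ∫ x, vecDiv φ x = 0 := by
  have hd := hφ.1.differentiable one_ne_zero
  have hcomp : ∀ i, ContDiff ℝ 1 fun x => φ x i := contDiff_euclidean.1 hφ.1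
  have hsupp : ∀ i, HasCompactSupport fun x => φ x i := fun i =>
    hφ.2.comp_left (g := fun y : ℝⁿ => y i) rfl
  have hpart : ∀ i x, fderiv ℝ φ x (EuclideanSpace.single i 1) i
      = fderiv ℝ (fun x => φ x i) x (EuclideanSpace.single i 1) := fun i x => by
    have h : fderiv ℝ (fun x => φ x i) x = (EuclideanSpace.proj i : ℝⁿ →L[ℝ] ℝ) ∘L fderiv ℝ φ x :=
      ((EuclideanSpace.proj i : ℝⁿ →L[ℝ] ℝ).hasFDerivAt.comp x (hd x).hasFDerivAt).fderiv
    rw [h]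
    rfl
  have hint : ∀ i, Integrable fun x => fderiv ℝ (fun x => φ x i) x (EuclideanSpace.single i 1) :=
    fun i => ((((hcomp i).continuous_fderiv one_ne_zero).clm_apply
      continuous_const)).integrable_of_hasCompactSupport ((hsupp i).fderiv_apply ℝ _)
  simp only [vecDiv, hpart]
  rw [integral_finsetSum _ fun i _ => hint i]
  refine Finset.sum_eq_zero fun i _ => ?_
  have := integral_mul_fderiv_eq_neg_fderiv_mul_of_integrable (μ := volume)
    (f := fun _ : ℝⁿ => (1 : ℝ))
    (g := fun x => φ x i) (v := EuclideanSpace.single i 1) (by simp) (by simpa using hint i)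
    (by simpa using (hcomp i).continuous.integrable_of_hasCompactSupport (hsupp i))
    (by simp) (fun x _ => (hcomp i).differentiable one_ne_zero x)
  simpa using this

theorem setIntegral_vecDiv_eq_zero {φ : ℝⁿ → ℝⁿ} (hφ : IsTestField φ) {A : Set ℝⁿ}
    (h : tsupport φ ⊆ A) : ∫ x in A, vecDiv φ x = 0 := by
  rw [setIntegral_eq_integral_of_forall_compl_eq_zero fun x hx =>
    vecDiv_eq_zero_of_notMem_tsupport fun hx' => hx (h hx'), integral_vecDiv_eq_zero hφ]

/-- A `C¹` cutoff function between a closed set and a larger closed set. -/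
theorem exists_cutoff {s t : Set ℝⁿ} (hs : IsClosed s) (ht : IsClosed t) (hst : s ⊆ interior t) :
    ∃ χ : ℝⁿ → ℝ, ContDiff ℝ 1 χ ∧ (∀ x ∈ s, ∀ᶠ y in 𝓝 x, χ y = 1) ∧ tsupport χ ⊆ t ∧
      ∀ x, χ x ∈ Icc 0 1 := by
  obtain ⟨f, h1, h0, h⟩ := exists_contMDiffMap_one_nhds_of_subset_interior (n := 1) 𝓘(ℝ, ℝⁿ) hs hst
  refine ⟨f, f.contMDiff.contDiff, fun x hx => ?_, ?_, h⟩
  · exact h1.filter_mono (nhds_le_nhdsSet hx)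
  · exact closure_minimal (fun x hx => by_contra fun hxt => hx (h0 x hxt)) ht

theorem exists_isTestField_nonneg (E : Set ℝⁿ) {φ : ℝⁿ → ℝⁿ} (hφ : IsTestField φ) :
    ∃ ψ : ℝⁿ → ℝⁿ, IsTestField ψ ∧ 0 ≤ ∫ x in E, vecDiv ψ x ∧
      ENNReal.ofReal (∫ x in E, vecDiv φ x) = ENNReal.ofReal (∫ x in E, vecDiv ψ x) := by
  rcases le_total 0 (∫ x in E, vecDiv φ x) with h | h
  · exact ⟨φ, hφ, h, rfl⟩
  · exact ⟨_, .zero, by simp [vecDiv_zero], by simp [vecDiv_zero, ENNReal.ofReal_of_nonpos h]⟩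

theorem per_add_le {A B : Set ℝⁿ} {c : ℝ≥0∞}
    (h : ∀ φ ψ : ℝⁿ → ℝⁿ, IsTestField φ → IsTestField ψ →
      ENNReal.ofReal ((∫ x in A, vecDiv φ x) + ∫ x in B, vecDiv ψ x) ≤ c) :
    per A + per B ≤ c := by
  have : Nonempty {φ : ℝⁿ → ℝⁿ // ContDiff ℝ 1 φ ∧ HasCompactSupport φ ∧ tsupport φ ⊆ univ ∧
      ∀ x, ‖φ x‖ ≤ 1} := ⟨⟨_, IsTestField.zero.1, IsTestField.zero.2, subset_univ _,
        IsTestField.zero.3⟩⟩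
  refine ENNReal.iSup_add_iSup_le fun φ ψ => ?_
  obtain ⟨φ', hφ', hφ0, hφe⟩ := exists_isTestField_nonneg A ⟨φ.2.1, φ.2.2.1, φ.2.2.2.2⟩
  obtain ⟨ψ', hψ', hψ0, hψe⟩ := exists_isTestField_nonneg B ⟨ψ.2.1, ψ.2.2.1, ψ.2.2.2.2⟩
  rw [hφe, hψe, ← ENNReal.ofReal_add hφ0 hψ0]
  exact h _ _ hφ' hψ'

/-- Removing a compact subset from an open set adds the perimeters. -/
theorem per_diff_eq_add {A K : Set ℝⁿ} (hA : IsOpen A) (hK : IsCompact K) (hKA : K ⊆ A) :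
    per (A \ K) = per A + per K := by
  have hdiff : ∀ φ : ℝⁿ → ℝⁿ, IsTestField φ →
      ∫ x in A \ K, vecDiv φ x = (∫ x in A, vecDiv φ x) - ∫ x in K, vecDiv φ x := fun φ hφ =>
    setIntegral_sdiff hK.measurableSet hφ.integrable.integrableOn hKA
  apply le_antisymm
  · refine per_le_iff.2 fun φ hφ => ?_
    have hneg : ∫ x in K, vecDiv (fun y => -φ y) x = -∫ x in K, vecDiv φ x := by
      simp only [vecDiv_neg, integral_neg]
    rw [hdiff φ hφ, sub_eq_add_neg, ← hneg]
    exact ENNReal.ofReal_add_le.trans (add_le_add (hφ.le_per A) (hφ.neg.le_per K))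
  · refine per_add_le fun φ ψ hφ hψ => ?_
    obtain ⟨K₁, hK₁, hKK₁, hK₁A⟩ := exists_compact_between hK hA hKA
    obtain ⟨K₂, hK₂, hK₁K₂, hK₂A⟩ := exists_compact_between hK₁ hA hK₁A
    obtain ⟨χ, hχ, hχ1, hχs, hχ01⟩ := exists_cutoff hK.isClosed hK₁.isClosed hKK₁
    obtain ⟨η, hη, hη1, hηs, hη01⟩ := exists_cutoff hK₁.isClosed hK₂.isClosed hK₁K₂
    have hηφ := hφ.smul hη hη01
    have hχψ := hψ.smul hχ hχ01
    have hdec : ∀ x, vecDiv (fun y => φ y + -(η y • φ y + χ y • ψ y)) x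
        = vecDiv φ x - (vecDiv (fun y => η y • φ y) x + vecDiv (fun y => χ y • ψ y) x) := fun x => by
      rw [vecDiv_add hφ.1 (hηφ.1.add hχψ.1).neg, vecDiv_neg, vecDiv_add hηφ.1 hχψ.1, sub_eq_add_neg]
    have hΦ : IsTestField (fun y => φ y + -(η y • φ y + χ y • ψ y)) := by
      refine ⟨hφ.1.add (hηφ.1.add hχψ.1).neg, hφ.2.add (hηφ.2.add hχψ.2).neg, fun x => ?_⟩
      by_cases hx : x ∈ K₁
      · rw [(hη1 x hx).self_of_nhds]
        simpa using hχψ.3 x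
      · rw [image_eq_zero_of_notMem_tsupport fun h => hx (hχs h)]
        have := (hφ.smul (contDiff_const.sub hη) (χ := fun y => 1 - η y)
          fun y => ⟨by linarith [(hη01 y).2], by linarith [(hη01 y).1]⟩).3 x
        rwa [show φ x + -(η x • φ x + (0 : ℝ) • ψ x) = (1 - η x) • φ x by module]
    refine le_trans (le_of_eq ?_) (hΦ.le_per _)
    have hAint : ∫ x in A, vecDiv (fun y => φ y + -(η y • φ y + χ y • ψ y)) x
        = ∫ x in A, vecDiv φ x := by
      simp only [hdec]
      rw [integral_sub hφ.integrable.integrableOn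
          (by exact hηφ.integrable.integrableOn.add hχψ.integrable.integrableOn),
        integral_add hηφ.integrable.integrableOn hχψ.integrable.integrableOn,
        setIntegral_vecDiv_eq_zero hηφ (((tsupport_smul_subset_left _ _).trans hηs).trans hK₂A),
        setIntegral_vecDiv_eq_zero hχψ (((tsupport_smul_subset_left _ _).trans hχs).trans hK₁A)]
      simp
    have hKint : ∫ x in K, vecDiv (fun y => φ y + -(η y • φ y + χ y • ψ y)) x
        = -∫ x in K, vecDiv ψ x := by
      rw [← integral_neg]
      refine setIntegral_congr_fun hK.measurableSet fun x hx => ?_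
      rw [← vecDiv_neg]
      apply vecDiv_congr
      filter_upwards [hχ1 x hx, hη1 x (interior_subset (hKK₁ hx))] with y h1 h2
      simp [h1, h2]
    rw [hdiff _ hΦ, hAint, hKint, sub_neg_eq_add]

theorem per_diff_biUnion {ι : Type*} {A : Set ℝⁿ} (hA : IsOpen A) (K : ι → Set ℝⁿ) (s : Finset ι)
    (hK : ∀ i ∈ s, IsCompact (K i)) (hKA : ∀ i ∈ s, K i ⊆ A)
    (hdisj : (s : Set ι).PairwiseDisjoint K) :
    per (A \ ⋃ i ∈ s, K i) = per A + ∑ i ∈ s, per (K i) := by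
  classical
  induction s using Finset.induction_on with
  | empty => simp
  | insert i s hi ih =>
    have hcpt : IsCompact (⋃ j ∈ s, K j) :=
      s.isCompact_biUnion fun j hj => hK j (Finset.mem_insert_of_mem hj)
    have hsub : K i ⊆ A \ ⋃ j ∈ s, K j := by
      refine subset_sdiff.2 ⟨hKA i (Finset.mem_insert_self _ _), ?_⟩
      refine disjoint_iUnion₂_right.2 fun j hj => hdisj (by simp) (by simp [hj]) ?_
      rintro rfl
      exact hi hj
    rw [Finset.set_biUnion_insert, union_comm, ← sdiff_sdiff,
      per_diff_eq_add (hA.sdiff hcpt.isClosed) (hK i (Finset.mem_insert_self _ _)) hsub,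
      ih (fun j hj => hK j (Finset.mem_insert_of_mem hj))
        (fun j hj => hKA j (Finset.mem_insert_of_mem hj))
        (hdisj.subset (by simp)), Finset.sum_insert hi, add_assoc, add_comm (per (K i))]

theorem vecDiv_comp_affine {φ : ℝⁿ → ℝⁿ} (hφ : ContDiff ℝ 1 φ) (a : ℝⁿ) (r : ℝ) (x : ℝⁿ) :
    vecDiv (fun y => φ (a + r • y)) x = r * vecDiv φ (a + r • x) := by
  have h1 : HasFDerivAt (fun y : ℝⁿ => a + r • y) (r • ContinuousLinearMap.id ℝ ℝⁿ) x :=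
    ((hasFDerivAt_id x).const_smul r).const_add a
  have h2 := ((hφ.differentiable one_ne_zero (a + r • x)).hasFDerivAt.comp x h1).fderiv
  simp only [Function.comp_def] at h2
  simp [vecDiv, h2, Finset.mul_sum]

theorem IsTestField.comp_affine {φ : ℝⁿ → ℝⁿ} (hφ : IsTestField φ) (a : ℝⁿ) {r : ℝ} (hr : r ≠ 0) :
    IsTestField (fun y => φ (a + r • y)) := by
  refine ⟨hφ.1.comp (contDiff_const.add (contDiff_id.const_smul r)), ?_, fun x => hφ.3 _⟩
  exact hφ.2.comp_homeomorph ((Homeomorph.smulOfNeZero r hr).trans (Homeomorph.addLeft a))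

theorem setIntegral_vadd_smul (f : ℝⁿ → ℝ) (a : ℝⁿ) {r : ℝ} (hr : 0 < r) (E : Set ℝⁿ) :
    ∫ x in a +ᵥ r • E, f x = r ^ n * ∫ x in E, f (a + r • x) := by
  have h1 : ∫ x in a +ᵥ r • E, f x = ∫ x in r • E, f (a + x) :=
    (measurePreserving_add_left volume a).setIntegral_image_emb
      (measurableEmbedding_addLeft a) f (r • E)
  rw [h1, Measure.setIntegral_comp_smul_of_pos volume (fun x => f (a + x)) E hr,
    finrank_euclideanSpace_fin, smul_eq_mul, mul_inv_cancel_left₀ (by positivity)]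

theorem per_vadd_smul_le (hn : 1 ≤ n) (E : Set ℝⁿ) (a : ℝⁿ) {r : ℝ} (hr : 0 < r) :
    per (a +ᵥ r • E) ≤ ENNReal.ofReal (r ^ (n - 1)) * per E := by
  refine per_le_iff.2 fun φ hφ => ?_
  have hint : ∫ x in a +ᵥ r • E, vecDiv φ x
      = r ^ (n - 1) * ∫ x in E, vecDiv (fun y => φ (a + r • y)) x := by
    simp only [setIntegral_vadd_smul _ a hr, vecDiv_comp_affine hφ.1, integral_const_mul]
    rw [← mul_assoc, ← pow_succ, Nat.sub_add_cancel hn]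
  rw [hint, ENNReal.ofReal_mul (by positivity)]
  gcongr
  exact (hφ.comp_affine a hr.ne').le_per E

theorem per_vadd_smul (hn : 1 ≤ n) (E : Set ℝⁿ) (a : ℝⁿ) {r : ℝ} (hr : 0 < r) :
    per (a +ᵥ r • E) = ENNReal.ofReal (r ^ (n - 1)) * per E := by
  refine (per_vadd_smul_le hn E a hr).antisymm ?_
  have h := per_vadd_smul_le hn (a +ᵥ r • E) (-(r⁻¹ • a)) (inv_pos.2 hr)
  have hE : -(r⁻¹ • a) +ᵥ r⁻¹ • (a +ᵥ r • E) = E := by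
    simp only [← image_smul, ← image_vadd, image_image, vadd_eq_add, smul_add, smul_smul,
      inv_mul_cancel₀ hr.ne', one_smul, neg_add_cancel_left, image_id']
  rw [hE] at h
  calc _ ≤ ENNReal.ofReal (r ^ (n - 1)) * (ENNReal.ofReal (r⁻¹ ^ (n - 1)) * per (a +ᵥ r • E)) := by
        gcongr
    _ = per (a +ᵥ r • E) := by
      rw [← mul_assoc, ← ENNReal.ofReal_mul (by positivity), ← mul_pow, mul_inv_cancel₀ hr.ne']
      simp

theorem per_pos (hn : 1 ≤ n) {G : Set ℝⁿ} (hG : Bornology.IsBounded G)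
    (hmeas : MeasurableSet G) (hpos : volume G ≠ 0) : 0 < per G := by
  obtain ⟨R, hR0, hR⟩ := hG.subset_ball_lt 0 0
  let b : ContDiffBump (0 : ℝⁿ) := ⟨R, R + 1, hR0, by linarith⟩
  have hφ : IsTestField (fun x => b x • (R + 1)⁻¹ • x) := by
    refine ⟨b.contDiff.smul (contDiff_id.const_smul _),
      b.hasCompactSupport.smul_right, fun x => ?_⟩
    by_cases hx : x ∈ ball 0 (R + 1)
    · rw [norm_smul, Real.norm_of_nonneg b.nonneg, norm_smul, Real.norm_of_nonneg (by positivity)]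
      refine mul_le_one₀ b.le_one (by positivity) ?_
      rw [inv_mul_le_one₀ (by positivity)]
      exact (mem_ball_zero_iff.1 hx).le
    · rw [b.zero_of_le_dist (not_lt.1 hx)]
      simp
  have hdiv : ∀ x ∈ G, vecDiv (fun x => b x • (R + 1)⁻¹ • x) x = n * (R + 1)⁻¹ := fun x hx => by
    have heq : (fun x => b x • (R + 1)⁻¹ • x) =ᶠ[𝓝 x] fun x => (R + 1)⁻¹ • x := by
      filter_upwards [b.eventuallyEq_one_of_mem_ball (hR hx)] with y hy
      simp [hy]
    have hderiv : fderiv ℝ (fun x : ℝⁿ => (R + 1)⁻¹ • x) x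
        = (R + 1)⁻¹ • ContinuousLinearMap.id ℝ ℝⁿ :=
      (show HasFDerivAt (fun x : ℝⁿ => (R + 1)⁻¹ • x) _ x from
        (hasFDerivAt_id (𝕜 := ℝ) x).const_smul (R + 1)⁻¹).fderiv
    rw [vecDiv_congr heq]
    simp [vecDiv, hderiv]
  refine lt_of_lt_of_le ?_ (hφ.le_per G)
  rw [setIntegral_congr_fun hmeas hdiv, setIntegral_const, smul_eq_mul, ENNReal.ofReal_pos]
  have : 0 < volume.real G := ENNReal.toReal_pos hpos hG.measure_lt_top.ne
  have : (0 : ℝ) < n := by exact_mod_cast hn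
  positivity

/-- A set of infinite perimeter can be enlarged inside a set that it does not fill, keeping the
perimeter infinite. -/
theorem exists_superset_per_eq_top (hn : 1 ≤ n) {E G : Set ℝⁿ} (hE : MeasurableSet E)
    (hG : MeasurableSet G) (hper : per E = ⊤) (hEfin : volume E ≠ ⊤) (hGE : volume (G \ E) ≠ 0) :
    ∃ E', MeasurableSet E' ∧ E' ⊆ E ∪ G ∧ per E' = ⊤ ∧ volume E < volume E' := by
  have : Nonempty (Fin n) := ⟨⟨0, hn⟩⟩
  obtain ⟨a, -, ha⟩ := exists_mem_forall_mem_nhdsWithin_pos_measure hGE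
  have hGEa : volume ((G \ E) \ {a}) ≠ 0 := by
    rwa [measure_sdiff_null (measure_singleton a)]
  obtain ⟨b, ⟨-, hba⟩, hb⟩ := exists_mem_forall_mem_nhdsWithin_pos_measure hGEa
  have hd : 0 < dist b a := dist_pos.2 hba
  set δ := dist b a / 4 with hδ
  have hδ0 : 0 < δ := by positivity
  have hlarger : ∀ c, 0 < volume ((G \ E) ∩ closedBall c δ) →
      volume E < volume (E ∪ G ∩ closedBall c δ) := fun c hc => by
    rw [← union_sdiff_self, measure_union disjoint_sdiff_right
      ((hG.inter isClosed_closedBall.measurableSet).diff hE)]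
    refine ENNReal.lt_add_right hEfin (hc.trans_le (measure_mono ?_)).ne'
    rintro x ⟨⟨hxG, hxE⟩, hx⟩
    exact ⟨⟨hxG, hx⟩, hxE⟩
  have hmeas : ∀ c, MeasurableSet (E ∪ G ∩ closedBall c δ) := fun c =>
    hE.union (hG.inter isClosed_closedBall.measurableSet)
  have hsub : ∀ c, E ∪ G ∩ closedBall c δ ⊆ E ∪ G := fun c =>
    union_subset_union_right _ inter_subset_left
  have hint : ∀ (c : ℝⁿ) (φ : ℝⁿ → ℝⁿ), (∀ x ∈ closedBall c δ, vecDiv φ x = 0) →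
      ∫ x in E, vecDiv φ x = ∫ x in E ∪ G ∩ closedBall c δ, vecDiv φ x := fun c φ h =>
    (setIntegral_eq_of_subset_of_forall_sdiff_eq_zero (hmeas c) subset_union_left
      fun x hx => h x (hx.1.resolve_left hx.2).2).symm
  have hsum : per E ≤ per (E ∪ G ∩ closedBall a δ) + per (E ∪ G ∩ closedBall b δ) := by
    obtain ⟨χ, hχ, hχ1, hχs, hχ01⟩ := exists_cutoff (s := closedBall a δ)
      (t := closedBall a (2 * δ)) isClosed_closedBall isClosed_closedBall
      ((closedBall_subset_ball (by linarith)).trans ball_subset_interior_closedBall)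
    refine per_le_iff.2 fun φ hφ => ?_
    have h1 := hφ.smul hχ hχ01
    have h2 := hφ.smul (contDiff_const.sub hχ) (χ := fun y => 1 - χ y)
      fun y => ⟨by linarith [(hχ01 y).2], by linarith [(hχ01 y).1]⟩
    have hdec : ∀ x, vecDiv φ x
        = vecDiv (fun y => (1 - χ y) • φ y) x + vecDiv (fun y => χ y • φ y) x := fun x => by
      rw [← vecDiv_add h2.1 h1.1]
      congr 1
      ext1 y
      module
    have ha0 : ∀ x ∈ closedBall a δ, vecDiv (fun y => (1 - χ y) • φ y) x = 0 := fun x hx => by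
      rw [← vecDiv_zero x]
      apply vecDiv_congr
      filter_upwards [hχ1 x hx] with y hy
      simp [hy]
    have hb0 : ∀ x ∈ closedBall b δ, vecDiv (fun y => χ y • φ y) x = 0 := fun x hx => by
      refine vecDiv_eq_zero_of_notMem_tsupport fun hx' => ?_
      have h3 : dist x a ≤ 2 * δ := hχs (tsupport_smul_subset_left _ _ hx')
      have h4 : dist x b ≤ δ := hx
      have := dist_triangle_left b a x
      linarith
    simp only [hdec]
    rw [integral_add h2.integrable.integrableOn h1.integrable.integrableOn, hint a _ ha0,
      hint b _ hb0]
    exact ENNReal.ofReal_add_le.trans (add_le_add (h2.le_per _) (h1.le_per _))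
  rw [hper, top_le_iff, ENNReal.add_eq_top] at hsum
  rcases hsum with h | h
  · exact ⟨_, hmeas a, hsub a, h, hlarger a
      (ha _ (inter_mem_nhdsWithin _ (closedBall_mem_nhds a hδ0)))⟩
  · exact ⟨_, hmeas b, hsub b, h, hlarger b
      ((hb _ (inter_mem_nhdsWithin _ (closedBall_mem_nhds b hδ0))).trans_le
        (measure_mono (inter_subset_inter_left _ sdiff_subset)))⟩

theorem exists_mul_pow_eq {k : ℕ} (hk : k ≠ 0) {c δ : ℝ} (hc : 0 < c) (hδ : 0 < δ) :
    ∃ (m : ℕ) (t : ℝ), 0 < m ∧ 0 < t ∧ t < δ ∧ m * t ^ k = c := by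
  obtain ⟨m, hm⟩ := exists_nat_gt (c / δ ^ k)
  have hm0 : (0 : ℝ) < m := lt_trans (by positivity) hm
  have ht : ((c / m) ^ (k : ℝ)⁻¹) ^ k = c / m := Real.rpow_inv_natCast_pow (by positivity) hk
  refine ⟨m, (c / m) ^ (k : ℝ)⁻¹, by exact_mod_cast hm0, by positivity, ?_, ?_⟩
  · refine lt_of_pow_lt_pow_left₀ k hδ.le ?_
    rw [ht, div_lt_iff₀ hm0, mul_comm]
    rwa [div_lt_iff₀ (by positivity)] at hm
  · rw [ht]
    field_simp

/-- The point of the integer grid with the given coordinates. -/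
noncomputable def gridPoint {m : ℕ} (j : Fin n → Fin m) : ℝⁿ :=
  WithLp.toLp 2 fun i => ((j i : ℕ) : ℝ)

theorem norm_gridPoint_le {m : ℕ} (j : Fin n → Fin m) : ‖gridPoint j‖ ≤ n * m := by
  rw [EuclideanSpace.norm_eq]
  refine Real.sqrt_le_iff.2 ⟨by positivity, ?_⟩
  have hsum : ∑ i, ‖gridPoint j i‖ ^ 2 ≤ ∑ _i : Fin n, (m : ℝ) ^ 2 := by
    refine Finset.sum_le_sum fun i _ => ?_
    simp only [gridPoint, Real.norm_natCast]
    gcongr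
    exact (j i).2.le
  refine hsum.trans ?_
  rw [Finset.sum_const, Finset.card_univ, Fintype.card_fin, nsmul_eq_mul, mul_pow]
  gcongr
  exact_mod_cast Nat.le_self_pow two_ne_zero n

theorem one_le_dist_gridPoint {m : ℕ} {j k : Fin n → Fin m} (h : j ≠ k) :
    1 ≤ dist (gridPoint j) (gridPoint k) := by
  obtain ⟨i, hi⟩ := Function.ne_iff.1 h
  have h1 : ‖(gridPoint j - gridPoint k) i‖ ≤ ‖gridPoint j - gridPoint k‖ := PiLp.norm_apply_le _ i
  rw [dist_eq_norm]
  refine le_trans ?_ h1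
  have h2 : ((j i : ℕ) : ℤ) - (k i : ℕ) ≠ 0 := by
    rw [sub_ne_zero]
    exact_mod_cast fun h => hi (Fin.ext h)
  have h3 := Int.one_le_abs h2
  simp only [gridPoint, PiLp.sub_apply, Real.norm_eq_abs]
  exact_mod_cast h3

/-- Removing many small copies of the closure of `G` from `G` increases the perimeter by a
prescribed amount while removing arbitrarily little volume. -/
theorem exists_subset_per_eq_add (hn : 2 ≤ n) {G : Set ℝⁿ} (hGopen : IsOpen G)
    (hGnull : volume (frontier G) = 0) (hGbdd : Bornology.IsBounded G) (hGper : per G ≠ ⊤)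
    {D : ℝ} (hD : 0 < D) {v : ℝ≥0∞} (hv : v < volume G) :
    ∃ E ⊆ G, MeasurableSet E ∧ per E = per G + ENNReal.ofReal D ∧ v < volume E := by
  have hn1 : 1 ≤ n := one_le_two.trans hn
  have hnR : (0 : ℝ) < n := by exact_mod_cast hn1
  have hvol : volume G ≠ 0 := (pos_of_gt hv).ne'
  have hfin : volume G ≠ ⊤ := hGbdd.measure_lt_top.ne
  have hclosure : closure G =ᵐ[volume] G := closure_ae_eq_of_null_frontier hGnull
  set p := (per G).toReal with hp
  have hp0 : 0 < p := ENNReal.toReal_pos (per_pos hn1 hGbdd hGopen.measurableSet hvol).ne' hGper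
  set V := (volume G).toReal with hV
  have hV0 : 0 < V := ENNReal.toReal_pos hvol hfin
  set w := v.toReal with hw
  have hwV : w < V := (ENNReal.toReal_lt_toReal hv.ne_top hfin).2 hv
  obtain ⟨a, ha⟩ := nonempty_of_measure_ne_zero hvol
  obtain ⟨ρ, hρ, hball⟩ := Metric.isOpen_iff.1 hGopen a ha
  obtain ⟨R, hR, hGR⟩ := hGbdd.closure.subset_closedBall_lt 0 0
  set s := ρ / (2 * n) with hs
  have hs0 : 0 < s := by positivity
  have hsn : s * n = ρ / 2 := by rw [hs]; field_simp
  have hsρ : s ≤ ρ / 2 := by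
    rw [← hsn]
    exact le_mul_of_one_le_right hs0.le (by exact_mod_cast hn1)
  obtain ⟨m, t, hm, ht, htδ, hmt⟩ := exists_mul_pow_eq (k := n - 1) (by omega) (div_pos hD hp0)
    (δ := min 1 (min (s / (2 * R)) ((V - w) / V)))
    (lt_min one_pos (lt_min (by positivity) (div_pos (sub_pos.2 hwV) hV0)))
  obtain ⟨ht1, htR, htV⟩ : t < 1 ∧ t < s / (2 * R) ∧ t < (V - w) / V := by
    simpa only [lt_min_iff] using htδ
  rw [lt_div_iff₀ (by positivity)] at htR
  rw [lt_div_iff₀ hV0] at htV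
  have hm0 : (0 : ℝ) < m := by exact_mod_cast hm
  have hm1 : (1 : ℝ) ≤ m := by exact_mod_cast hm
  have htm : 0 < t / m := by positivity
  let x : (Fin n → Fin m) → ℝⁿ := fun j => a + (s / m) • gridPoint j
  let K : (Fin n → Fin m) → Set ℝⁿ := fun j => x j +ᵥ (t / m) • closure G
  have hKball : ∀ j, K j ⊆ closedBall (x j) (t / m * R) := by
    rintro j _ ⟨_, ⟨y, hy, rfl⟩, rfl⟩
    have hy' := mem_closedBall_zero_iff.1 (hGR hy)
    simp only [vadd_eq_add, mem_closedBall, dist_self_add_left, norm_smul,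
      Real.norm_of_nonneg htm.le]
    gcongr
  have hKcpt : ∀ j, IsCompact (K j) := fun j => (hGbdd.isCompact_closure.smul (t / m)).vadd (x j)
  have hKG : ∀ j, K j ⊆ G := fun j => by
    refine (hKball j).trans (subset_trans (closedBall_subset_ball' ?_) hball)
    have h1 : dist (x j) a ≤ ρ / 2 := by
      simp only [x, dist_self_add_left, norm_smul, Real.norm_of_nonneg (div_pos hs0 hm0).le]
      calc s / m * ‖gridPoint j‖ ≤ s / m * (n * m) := by gcongr; exact norm_gridPoint_le j
        _ = ρ / 2 := by rw [← hsn]; field_simp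
    have h2 : t / m * R ≤ t * R := by
      gcongr
      exact div_le_self ht.le hm1
    linarith
  have hdisj : ((Finset.univ : Finset (Fin n → Fin m)) : Set (Fin n → Fin m)).PairwiseDisjoint K := by
    intro j _ k _ hjk
    refine (closedBall_disjoint_closedBall ?_).mono (hKball j) (hKball k)
    have h1 : dist (x j) (x k) = s / m * dist (gridPoint j) (gridPoint k) := by
      simp only [x, dist_add_left, dist_smul₀, Real.norm_of_nonneg (div_pos hs0 hm0).le]
    rw [h1]
    calc t / m * R + t / m * R = (t * (2 * R)) / m := by ring
      _ < s / m := by gcongr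
      _ ≤ _ := le_mul_of_one_le_right (div_pos hs0 hm0).le (one_le_dist_gridPoint hjk)
  have hcard : (Finset.univ : Finset (Fin n → Fin m)).card = m ^ n := by simp
  have hpow : ((m ^ n : ℕ) : ℝ≥0∞) = ENNReal.ofReal ((m : ℝ) ^ n) := by
    rw [← Nat.cast_pow, ENNReal.ofReal_natCast]
  have hKper : ∑ j, per (K j) = ENNReal.ofReal D := by
    have hsum : (m : ℝ) ^ n * ((t / m) ^ (n - 1) * p) = D := by
      have : (m : ℝ) ^ n = m * m ^ (n - 1) := by rw [← pow_succ', Nat.sub_add_cancel hn1]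
      rw [div_pow, this]
      field_simp at hmt ⊢
      linarith
    simp only [K, per_vadd_smul hn1 _ _ htm, per_congr_ae hclosure]
    rw [Finset.sum_const, hcard, nsmul_eq_mul, hpow, ← ENNReal.ofReal_toReal hGper, ← hp,
      ← ENNReal.ofReal_mul (by positivity), ← ENNReal.ofReal_mul (by positivity), hsum]
  have hKvol : volume (⋃ j ∈ Finset.univ, K j) ≤ ENNReal.ofReal (t * V) := by
    refine (measure_biUnion_finset_le _ _).trans ?_
    have hj : ∀ j, volume (K j) = ENNReal.ofReal ((t / m) ^ n * V) := fun j => by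
      rw [measure_vadd, Measure.addHaar_smul_of_nonneg _ htm.le, finrank_euclideanSpace_fin,
        measure_congr hclosure, ENNReal.ofReal_mul (by positivity), ENNReal.ofReal_toReal hfin]
    simp only [hj]
    rw [Finset.sum_const, hcard, nsmul_eq_mul, hpow, ← ENNReal.ofReal_mul (by positivity)]
    apply ENNReal.ofReal_le_ofReal
    calc (m : ℝ) ^ n * ((t / m) ^ n * V) = t ^ n * V := by rw [div_pow]; field_simp
      _ ≤ t * V := by gcongr; exact pow_le_of_le_one ht.le ht1.le (by omega)
  refine ⟨G \ ⋃ j ∈ Finset.univ, K j, sdiff_subset, ?_, ?_, ?_⟩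
  · exact hGopen.measurableSet.diff
      (Finset.measurableSet_biUnion _ fun j _ => (hKcpt j).measurableSet)
  · rw [per_diff_biUnion hGopen K _ (fun j _ => hKcpt j) (fun j _ => hKG j) hdisj, hKper]
  · refine lt_of_lt_of_le ?_ le_measure_sdiff
    rw [lt_tsub_iff_right]
    refine (add_le_add_right hKvol v).trans_lt ?_
    rw [← ENNReal.ofReal_toReal hv.ne_top, ← ENNReal.ofReal_toReal hfin,
      ← ENNReal.ofReal_add ENNReal.toReal_nonneg (by positivity),
      ENNReal.ofReal_lt_ofReal_iff hV0]
    linarith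

end Perimeter

/-- Existence in bounded subregions, part ii): if `L > Per(G)` there is no volume-maximal
subset of `cl(G)` with perimeter `L`. -/
theorem nonexistence_above_perimeter (n : ℕ) (hn : 2 ≤ n)
    (G : Set (EuclideanSpace ℝ (Fin n))) (hGopen : IsOpen G)
    (hGnull : volume (frontier G) = 0) (hGbdd : Bornology.IsBounded G)
    (hGper : per G < ⊤) (L : ℝ≥0∞) (hL : per G < L) :
    ∀ E : Set (EuclideanSpace ℝ (Fin n)), MeasurableSet E → E ⊆ closure G → per E = L →
      ∃ E' : Set (EuclideanSpace ℝ (Fin n)), MeasurableSet E' ∧ E' ⊆ closure G ∧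
        per E' = L ∧ volume E < volume E' := by
  intro E hE hEG hperE
  have hclosure : closure G =ᵐ[volume] G := closure_ae_eq_of_null_frontier hGnull
  have hfin : volume G ≠ ⊤ := hGbdd.measure_lt_top.ne
  have hlt : volume E < volume G := by
    rw [← measure_congr hclosure] at hfin ⊢
    refine lt_of_le_of_ne (measure_mono hEG) fun h => hL.ne ?_
    rw [← hperE, ← per_congr_ae hclosure]
    exact (per_congr_ae (ae_eq_of_subset_of_measure_ge hEG h.ge hE.nullMeasurableSet hfin)).symm
  rcases eq_or_ne L ⊤ with rfl | hLtop
  · have hGE : volume (G \ E) ≠ 0 := fun h =>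
      hlt.not_ge (measure_mono_ae (ae_le_set.2 h))
    obtain ⟨E', hE', hsub, hper, hvol⟩ := exists_superset_per_eq_top (one_le_two.trans hn) hE
      hGopen.measurableSet hperE hlt.ne_top hGE
    exact ⟨E', hE', hsub.trans (Set.union_subset hEG subset_closure), hper, hvol⟩
  · have hD : 0 < (L - per G).toReal :=
      ENNReal.toReal_pos (tsub_pos_of_lt hL).ne' (ENNReal.sub_ne_top hLtop)
    obtain ⟨E', hsub, hE', hper, hvol⟩ :=
      exists_subset_per_eq_add hn hGopen hGnull hGbdd hGper.ne hD hlt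
    refine ⟨E', hE', hsub.trans subset_closure, ?_, hvol⟩
    rw [hper, ENNReal.ofReal_toReal (ENNReal.sub_ne_top hLtop), add_tsub_cancel_of_le hL.le]
end

section
/- Let n ≥ 2 and let G ⊆ ℝⁿ be a bounded subregion. Then for every A ∈ [0, Lⁿ(G)) there exists a Lebesgue measurable set E ⊆ cl(G) with Lⁿ(E) = A and Per(E) ≤ Per(E') for every measurable E' ⊆ cl(G) with Lⁿ(E') = A; in particular the infimum defining the isoperimetric profile of G is attained. -/
open MeasureTheory
open scoped ENNReal

open Filter Topology

section

variable {n : ℕ}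

theorem integral_vecDiv_le {E : Set (EuclideanSpace ℝ (Fin n))} {P : ℝ} (hP : 0 ≤ P)
    (hE : per E ≤ ENNReal.ofReal P)
    {φ : EuclideanSpace ℝ (Fin n) → EuclideanSpace ℝ (Fin n)} (hφ : ContDiff ℝ 1 φ)
    (hφc : HasCompactSupport φ) (hφ1 : ∀ x, ‖φ x‖ ≤ 1) :
    ∫ x in E, vecDiv φ x ≤ P := by
  refine (ENNReal.ofReal_le_ofReal_iff hP).1 (le_trans ?_ hE)
  exact le_iSup (fun φ : {φ : EuclideanSpace ℝ (Fin n) → EuclideanSpace ℝ (Fin n) //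
      ContDiff ℝ 1 φ ∧ HasCompactSupport φ ∧ tsupport φ ⊆ Set.univ ∧ ∀ x, ‖φ x‖ ≤ 1} ↦
    ENNReal.ofReal (∫ x in E, vecDiv φ.1 x)) ⟨φ, hφ, hφc, Set.subset_univ _, hφ1⟩

theorem vecDiv_smul_const {f : EuclideanSpace ℝ (Fin n) → ℝ} {x : EuclideanSpace ℝ (Fin n)}
    (hf : DifferentiableAt ℝ f x) (e : EuclideanSpace ℝ (Fin n)) :
    vecDiv (fun y ↦ f y • e) x = fderiv ℝ f x e := by
  have h := (hf.hasFDerivAt.smul_const e).fderiv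
  simp only [vecDiv, h, ContinuousLinearMap.smulRight_apply, PiLp.smul_apply, smul_eq_mul]
  conv_rhs => rw [← (EuclideanSpace.basisFun (Fin n) ℝ).sum_repr e, map_sum]
  refine Finset.sum_congr rfl fun i _ ↦ ?_
  simp [mul_comm]

/-- The mean value inequality for the translates of a test function, integrated over a set of
finite perimeter. -/
theorem setIntegral_translate_sub_le {E : Set (EuclideanSpace ℝ (Fin n))} {P : ℝ} (hP : 0 ≤ P)
    (hE : per E ≤ ENNReal.ofReal P) (hvol : volume E ≠ ∞)
    {ψ : EuclideanSpace ℝ (Fin n) → ℝ} (hψ : ContDiff ℝ 1 ψ) (hψc : HasCompactSupport ψ)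
    (hψ1 : ∀ x, |ψ x| ≤ 1) {e : EuclideanSpace ℝ (Fin n)} (he : ‖e‖ ≤ 1) {t : ℝ} (ht : 0 ≤ t) :
    (∫ x in E, ψ (x - t • e)) - ∫ x in E, ψ x ≤ P * t := by
  have : IsFiniteMeasure (volume.restrict E) := ⟨by simpa using hvol.lt_top⟩
  have hψ' : Continuous (fderiv ℝ ψ) := hψ.continuous_fderiv one_ne_zero
  obtain ⟨C, hC⟩ := (hψc.fderiv (𝕜 := ℝ)).exists_bound_of_continuous hψ'
  have hψd : Differentiable ℝ ψ := hψ.differentiable one_ne_zero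
  have hderiv : ∀ s : ℝ, HasDerivAt (fun s : ℝ ↦ ∫ x in E, ψ (x - s • e))
      (∫ x in E, fderiv ℝ ψ (x - s • e) (-e)) s := by
    intro s
    refine (hasDerivAt_integral_of_dominated_loc_of_deriv_le
      (F' := fun s x ↦ fderiv ℝ ψ (x - s • e) (-e)) (bound := fun _ ↦ C * ‖-e‖)
      (s := Set.univ) Filter.univ_mem ?_ ?_ ?_ ?_ (integrable_const _) ?_).2
    · exact .of_forall fun s ↦
        (hψ.continuous.comp (continuous_id.sub continuous_const)).aestronglyMeasurable
    · exact Integrable.of_bound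
        (hψ.continuous.comp (continuous_id.sub continuous_const)).aestronglyMeasurable 1
        (.of_forall fun x ↦ hψ1 _)
    · exact ((hψ'.comp (continuous_id.sub continuous_const)).clm_apply
        continuous_const).aestronglyMeasurable
    · exact .of_forall fun x s _ ↦ (ContinuousLinearMap.le_opNorm _ _).trans
        (mul_le_mul_of_nonneg_right (hC _) (norm_nonneg _))
    · refine .of_forall fun x s _ ↦ ?_
      have h1 : HasDerivAt (fun s : ℝ ↦ x - s • e) (-e) s := by
        simpa using ((hasDerivAt_id s).smul_const e).const_sub x
      exact (hψd _).hasFDerivAt.comp_hasDerivAt s h1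
  have hle : ∀ s : ℝ, deriv (fun s : ℝ ↦ ∫ x in E, ψ (x - s • e)) s ≤ P := by
    intro s
    have hcd : ContDiff ℝ 1 fun x ↦ ψ (x - s • e) := hψ.comp (contDiff_id.sub contDiff_const)
    have hsub : ∀ x, fderiv ℝ ψ (x - s • e) (-e) = vecDiv (fun y ↦ ψ (y - s • e) • (-e)) x := by
      intro x
      rw [vecDiv_smul_const (hcd.differentiable one_ne_zero x), fderiv_comp_sub]
    rw [(hderiv s).deriv]
    simp_rw [hsub]
    refine integral_vecDiv_le hP hE (hcd.smul contDiff_const) ?_ fun x ↦ ?_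
    · have h2 : HasCompactSupport fun x ↦ ψ (x - s • e) := by
        simpa [sub_eq_add_neg] using! hψc.comp_homeomorph (Homeomorph.addRight (-(s • e)))
      exact h2.smul_right
    · rw [norm_smul, norm_neg]
      exact mul_le_one₀ (hψ1 _) (norm_nonneg _) he
  simpa using image_sub_le_mul_sub_of_deriv_le (fun s ↦ (hderiv s).differentiableAt) hle ht

/-- A set of finite perimeter moves little in measure under translation. -/
theorem volume_symmDiff_translate_le {E : Set (EuclideanSpace ℝ (Fin n))} {P : ℝ} (hP : 0 ≤ P)
    (hE : per E ≤ ENNReal.ofReal P) (hEm : MeasurableSet E) (hEb : Bornology.IsBounded E)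
    {e : EuclideanSpace ℝ (Fin n)} (he : ‖e‖ ≤ 1) {t : ℝ} (ht : 0 ≤ t) :
    volume (symmDiff E ((fun x ↦ x + t • e) ⁻¹' E)) ≤ ENNReal.ofReal (P * t) := by
  set T : Set (EuclideanSpace ℝ (Fin n)) := (fun x ↦ x + t • e) ⁻¹' E with hT
  have hTm : MeasurableSet T := (measurable_add_const _) hEm
  have hTb : Bornology.IsBounded T :=
    (IsometryEquiv.addRight (t • e)).isometry.antilipschitz.isBounded_preimage hEb
  have hEv : volume E ≠ ∞ := hEb.measure_lt_top.ne
  have hTv : volume T ≠ ∞ := hTb.measure_lt_top.ne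
  set s : EuclideanSpace ℝ (Fin n) → ℝ := fun x ↦ T.indicator 1 x - E.indicator 1 x with hs
  have hsm : Measurable s := (measurable_one.indicator hTm).sub (measurable_one.indicator hEm)
  have hs1 : ∀ x, |s x| ≤ 1 := by
    intro x
    by_cases h1 : x ∈ T <;> by_cases h2 : x ∈ E <;> simp [hs, h1, h2]
  have hs2 : ∀ x, s x * s x = (symmDiff E T).indicator 1 x := by
    intro x
    by_cases h1 : x ∈ T <;> by_cases h2 : x ∈ E <;> simp [hs, h1, h2, Set.mem_symmDiff]
  have hsi : Integrable s := ((integrable_indicator_iff hTm).2 (integrableOn_const hTv)).sub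
    ((integrable_indicator_iff hEm).2 (integrableOn_const hEv))
  have hsc : HasCompactSupport s := by
    refine HasCompactSupport.of_support_subset_isCompact
      ((hEb.union hTb).isCompact_closure) (subset_trans ?_ subset_closure)
    intro x hx
    by_contra h
    simp only [Set.mem_union, not_or] at h
    simp [hs, h.1, h.2] at hx
  let b : ℕ → ContDiffBump (0 : EuclideanSpace ℝ (Fin n)) := fun j ↦
    { rIn := 1 / ((j : ℝ) + 1)
      rOut := 2 * (1 / ((j : ℝ) + 1))
      rIn_pos := by positivity
      rIn_lt_rOut := by
        have : 0 < 1 / ((j : ℝ) + 1) := by positivity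
        linarith }
  let ψ : ℕ → EuclideanSpace ℝ (Fin n) → ℝ := fun j ↦
    convolution ((b j).normed volume) s (ContinuousLinearMap.lsmul ℝ ℝ) volume
  have hlim : ∀ᵐ x, Tendsto (fun j ↦ ψ j x) atTop (𝓝 (s x)) := by
    refine ContDiffBump.ae_convolution_tendsto_right_of_locallyIntegrable (K := 2) ?_
      (.of_forall fun j ↦ le_rfl) hsi.locallyIntegrable
    simpa [b] using tendsto_one_div_add_atTop_nhds_zero_nat.const_mul (2 : ℝ)
  have hψ : ∀ j, ContDiff ℝ 1 (ψ j) := fun j ↦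
    (b j).hasCompactSupport_normed.contDiff_convolution_left _ (b j).contDiff_normed
      hsi.locallyIntegrable
  have hψc : ∀ j, HasCompactSupport (ψ j) := fun j ↦
    (b j).hasCompactSupport_normed.convolution _ hsc
  have hψ1 : ∀ j x, |ψ j x| ≤ 1 := by
    intro j x
    have := dist_convolution_le (μ := volume) (f := (b j).normed volume) (g := s) (x₀ := x)
      (z₀ := 0) zero_le_one ((b j).support_normed_eq.subset) (b j).nonneg_normed
      (b j).integral_normed hsm.aestronglyMeasurable fun y _ ↦ by simpa using hs1 y
    simpa using this
  have hle : ∀ j, ∫ x, s x * ψ j x ≤ P * t := by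
    intro j
    have hψi : Integrable (ψ j) := (hψ j).continuous.integrable_of_hasCompactSupport (hψc j)
    refine le_trans (le_of_eq ?_)
      (setIntegral_translate_sub_le hP hE hEv (hψ j) (hψc j) (hψ1 j) he ht)
    have h1 : ∫ x in E, ψ j (x - t • e) = ∫ x in T, ψ j x := by
      rw [← integral_indicator hEm, ← integral_indicator hTm,
        ← integral_add_right_eq_self _ (t • e)]
      congr 1
      ext x
      by_cases h : x + t • e ∈ E <;> simp [hT, h]
    rw [h1, ← integral_indicator hTm, ← integral_indicator hEm,
      ← integral_sub (hψi.indicator hTm) (hψi.indicator hEm)]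
    congr 1
    ext x
    by_cases h1 : x ∈ T <;> by_cases h2 : x ∈ E <;> simp [hs, h1, h2]
  have hconv : Tendsto (fun j ↦ ∫ x, s x * ψ j x) atTop (𝓝 (∫ x, s x * s x)) := by
    refine tendsto_integral_of_dominated_convergence (fun x ↦ ‖s x‖)
      (fun j ↦ hsm.aestronglyMeasurable.mul (hψ j).continuous.aestronglyMeasurable) hsi.norm
      (fun j ↦ .of_forall fun x ↦ ?_) ?_
    · rw [norm_mul]
      exact mul_le_of_le_one_right (norm_nonneg _) (hψ1 j x)
    · filter_upwards [hlim] with x hx using hx.const_mul _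
  have hfin := le_of_tendsto' hconv hle
  have hST : volume (symmDiff E T) ≠ ∞ :=
    measure_ne_top_of_subset Set.symmDiff_subset_union (measure_union_ne_top hEv hTv)
  rw [← ENNReal.ofReal_toReal hST]
  refine ENNReal.ofReal_le_ofReal (le_trans (le_of_eq ?_) hfin)
  simp_rw [hs2]
  rw [integral_indicator_one (hEm.symmDiff hTm), Measure.real]

/-- The indicator of a set of finite perimeter is `L¹`-close to its averages over small balls. -/
theorem lintegral_enorm_indicator_sub_measureReal_inter_ball_le
    {E : Set (EuclideanSpace ℝ (Fin n))} {P : ℝ} (hP : 0 ≤ P)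
    (hE : per E ≤ ENNReal.ofReal P) (hEm : MeasurableSet E) (hEb : Bornology.IsBounded E)
    {ε : ℝ} (hε : 0 < ε) :
    ∫⁻ x, ‖volume.real (Metric.ball (0 : EuclideanSpace ℝ (Fin n)) ε) * E.indicator 1 x -
        volume.real (E ∩ Metric.ball x ε)‖ₑ ≤
      volume (Metric.ball (0 : EuclideanSpace ℝ (Fin n)) ε) * ENNReal.ofReal (P * ε) := by
  set B := Metric.ball (0 : EuclideanSpace ℝ (Fin n)) ε with hB
  let f : EuclideanSpace ℝ (Fin n) → EuclideanSpace ℝ (Fin n) → ℝ :=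
    fun x h ↦ E.indicator 1 x - E.indicator 1 (x + h)
  have hind : Measurable (E.indicator (1 : EuclideanSpace ℝ (Fin n) → ℝ)) :=
    measurable_one.indicator hEm
  have hfm : Measurable (Function.uncurry f) :=
    (hind.comp measurable_fst).sub (hind.comp (measurable_fst.add measurable_snd))
  have hBv : volume B ≠ ∞ := measure_ball_lt_top.ne
  have hEv : volume E ≠ ∞ := hEb.measure_lt_top.ne
  have hfin : IsFiniteMeasure (volume.restrict B) := ⟨by simpa using hBv.lt_top⟩
  have hrep : ∀ x, volume.real B * E.indicator 1 x - volume.real (E ∩ Metric.ball x ε) =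
      ∫ h in B, f x h := by
    intro x
    have hpre : MeasurableSet ((fun h ↦ x + h) ⁻¹' E) := measurable_const_add x hEm
    have h1 : (fun h ↦ E.indicator (1 : EuclideanSpace ℝ (Fin n) → ℝ) (x + h)) =
        ((fun h ↦ x + h) ⁻¹' E).indicator 1 := rfl
    have h2 : (fun h ↦ x + h) ⁻¹' (E ∩ Metric.ball x ε) = ((fun h ↦ x + h) ⁻¹' E) ∩ B := by
      ext h
      simp [hB]
    simp only [f]
    rw [integral_sub (integrable_const _), integral_const, h1, integral_indicator_one hpre,
      measureReal_restrict_apply hpre, ← h2, measureReal_restrict_apply_univ, smul_eq_mul,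
      Measure.real, Measure.real, Measure.real, measure_preimage_add]
    rw [h1]
    exact (integrable_const (1 : ℝ)).indicator hpre
  have hinner : ∀ h ∈ B, ∫⁻ x, ‖f x h‖ₑ ≤ ENNReal.ofReal (P * ε) := by
    intro h hh
    have hh' : ‖h‖ < ε := by simpa [hB] using hh
    have he : ‖ε⁻¹ • h‖ ≤ 1 := by
      rw [norm_smul, norm_inv, Real.norm_of_nonneg hε.le, inv_mul_le_iff₀ hε]
      simpa using hh'.le
    have key := volume_symmDiff_translate_le hP hE hEm hEb he hε.le
    rw [smul_inv_smul₀ hε.ne'] at key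
    refine le_trans (le_of_eq ?_) key
    have hpre : MeasurableSet ((fun x ↦ x + h) ⁻¹' E) := measurable_add_const h hEm
    rw [← lintegral_indicator_one (hEm.symmDiff hpre)]
    congr 1
    ext x
    by_cases h1 : x ∈ E <;> by_cases h2 : x + h ∈ E <;> simp [f, h1, h2, Set.mem_symmDiff]
  simp_rw [hrep]
  calc ∫⁻ x, ‖∫ h in B, f x h‖ₑ ≤ ∫⁻ x, ∫⁻ h in B, ‖f x h‖ₑ :=
        lintegral_mono fun x ↦ enorm_integral_le_lintegral_enorm _
    _ = ∫⁻ h in B, ∫⁻ x, ‖f x h‖ₑ := lintegral_lintegral_swap hfm.enorm.aemeasurable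
    _ ≤ ∫⁻ h in B, ENNReal.ofReal (P * ε) :=
        setLIntegral_mono measurable_const hinner
    _ = volume B * ENNReal.ofReal (P * ε) := by rw [setLIntegral_const, mul_comm]

theorem measurable_measureReal_inter_ball {E : Set (EuclideanSpace ℝ (Fin n))}
    (hEm : MeasurableSet E) (ε : ℝ) :
    Measurable fun x ↦ volume.real (E ∩ Metric.ball x ε) := by
  have hs : MeasurableSet {p : EuclideanSpace ℝ (Fin n) × EuclideanSpace ℝ (Fin n) |
      p.2 ∈ E ∧ dist p.2 p.1 < ε} :=
    (measurable_snd hEm).inter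
      (measurableSet_lt (measurable_snd.dist measurable_fst) measurable_const)
  exact (measurable_measure_prodMk_left (ν := volume) hs).ennreal_toReal

/-- A sequence of sets of uniformly bounded perimeter in a fixed bounded set whose averages over
small balls converge pointwise is Cauchy in measure. -/
theorem tendsto_volume_symmDiff {E : ℕ → Set (EuclideanSpace ℝ (Fin n))} {P : ℝ} (hP : 0 ≤ P)
    (hE : ∀ k, per (E k) ≤ ENNReal.ofReal P) (hEm : ∀ k, MeasurableSet (E k))
    {K : Set (EuclideanSpace ℝ (Fin n))} (hK : Bornology.IsBounded K) (hEK : ∀ k, E k ⊆ K)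
    (hlim : ∀ x, ∀ ε : ℝ, ∃ c : ℝ,
      Tendsto (fun k ↦ volume.real (E k ∩ Metric.ball x ε)) atTop (𝓝 c)) :
    Tendsto (fun p : ℕ × ℕ ↦ volume (symmDiff (E p.1) (E p.2))) atTop (𝓝 0) := by
  have hEb : ∀ k, Bornology.IsBounded (E k) := fun k ↦ hK.subset (hEK k)
  have hest : ∀ ε : ℝ, 0 < ε → ∀ᶠ p : ℕ × ℕ in atTop,
      volume (symmDiff (E p.1) (E p.2)) ≤ 3 * ENNReal.ofReal (P * ε + ε) := by
    intro ε hε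
    set B := Metric.ball (0 : EuclideanSpace ℝ (Fin n)) ε with hB
    have hBv : volume B ≠ ∞ := measure_ball_lt_top.ne
    have hB0 : volume B ≠ 0 := (Metric.measure_ball_pos _ _ hε).ne'
    have hball : ∀ x : EuclideanSpace ℝ (Fin n), volume (Metric.ball x ε) = volume B :=
      fun x ↦ Measure.addHaar_ball_center _ _ _
    let u : ℕ → EuclideanSpace ℝ (Fin n) → ℝ := fun k x ↦ volume.real (E k ∩ Metric.ball x ε)
    have hum : ∀ k, Measurable (u k) := fun k ↦ measurable_measureReal_inter_ball (hEm k) ε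
    have hu0 : ∀ k x, x ∉ Metric.thickening ε K → u k x = 0 := by
      intro k x hx
      have : E k ∩ Metric.ball x ε = ∅ := by
        by_contra! hne
        obtain ⟨y, hy, hyx⟩ := hne
        exact hx (Metric.mem_thickening_iff.2 ⟨y, hEK k hy, by rwa [dist_comm]⟩)
      simp [u, this]
    have hu1 : ∀ k x, ‖u k x‖ ≤ volume.real B := by
      intro k x
      rw [Real.norm_of_nonneg measureReal_nonneg, Measure.real, Measure.real, ← hball x]
      exact ENNReal.toReal_mono measure_ball_lt_top.ne (measure_mono Set.inter_subset_right)
    have hmid : Tendsto (fun p : ℕ × ℕ ↦ ∫⁻ x, ‖u p.1 x - u p.2 x‖ₑ) atTop (𝓝 0) := by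
      have h0 : ∫⁻ _ : EuclideanSpace ℝ (Fin n), (0 : ℝ≥0∞) = 0 := lintegral_zero
      rw [← h0]
      refine tendsto_lintegral_filter_of_dominated_convergence
        ((Metric.thickening ε K).indicator fun _ ↦ ENNReal.ofReal (2 * volume.real B))
        (.of_forall fun p ↦ ((hum _).sub (hum _)).enorm) (.of_forall fun p ↦ .of_forall fun x ↦ ?_)
        ?_ (.of_forall fun x ↦ ?_)
      · by_cases hx : x ∈ Metric.thickening ε K
        · rw [Set.indicator_of_mem hx, ← ofReal_norm]
          refine ENNReal.ofReal_le_ofReal ((norm_sub_le _ _).trans ?_)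
          linarith [hu1 p.1 x, hu1 p.2 x]
        · simp [hx, hu0 _ x hx]
      · rw [lintegral_indicator Metric.isOpen_thickening.measurableSet, setLIntegral_const]
        exact ENNReal.mul_ne_top ENNReal.ofReal_ne_top hK.thickening.measure_lt_top.ne
      · obtain ⟨c, hc⟩ := hlim x ε
        have h1 : Tendsto (fun p : ℕ × ℕ ↦ u p.1 x - u p.2 x) atTop (𝓝 (c - c)) := by
          rw [← prod_atTop_atTop_eq]
          exact (hc.comp tendsto_fst).sub (hc.comp tendsto_snd)
        simpa [Function.comp_def] using (continuous_enorm.tendsto _).comp h1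
    have hpos : 0 < volume B * ENNReal.ofReal (P * ε + ε) :=
      ENNReal.mul_pos hB0 (by simpa using by positivity)
    filter_upwards [hmid.eventually_le_const hpos] with p hp
    let w : ℕ → EuclideanSpace ℝ (Fin n) → ℝ :=
      fun k x ↦ volume.real B * (E k).indicator 1 x - u k x
    have hwm : ∀ k, Measurable (w k) := fun k ↦
      ((measurable_one.indicator (hEm k)).const_mul _).sub (hum k)
    have hw : ∀ k, ∫⁻ x, ‖w k x‖ₑ ≤ volume B * ENNReal.ofReal (P * ε + ε) := fun k ↦
      (lintegral_enorm_indicator_sub_measureReal_inter_ball_le hP (hE k) (hEm k) (hEb k) hε).trans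
        (by gcongr; linarith)
    have hsum : volume B * volume (symmDiff (E p.1) (E p.2)) ≤
        volume B * (3 * ENNReal.ofReal (P * ε + ε)) := by
      calc volume B * volume (symmDiff (E p.1) (E p.2))
          = ∫⁻ x, volume B * (symmDiff (E p.1) (E p.2)).indicator 1 x := by
            rw [lintegral_const_mul _ (measurable_one.indicator ((hEm _).symmDiff (hEm _))),
              lintegral_indicator_one ((hEm _).symmDiff (hEm _))]
        _ ≤ ∫⁻ x, (‖w p.1 x‖ₑ + ‖u p.1 x - u p.2 x‖ₑ + ‖w p.2 x‖ₑ) := by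
            refine lintegral_mono fun x ↦ ?_
            have h1 : volume B * (symmDiff (E p.1) (E p.2)).indicator 1 x =
                ‖volume.real B * (E p.1).indicator 1 x -
                  volume.real B * (E p.2).indicator 1 x‖ₑ := by
              have h3 : ‖volume.real B‖ₑ = volume B := by
                rw [Real.enorm_of_nonneg measureReal_nonneg, Measure.real,
                  ENNReal.ofReal_toReal hBv]
              by_cases h1 : x ∈ E p.1 <;> by_cases h2 : x ∈ E p.2 <;>
                simp [h1, h2, h3, Set.mem_symmDiff]
            have h2 : volume.real B * (E p.1).indicator 1 x -
                volume.real B * (E p.2).indicator 1 x =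
                w p.1 x + (u p.1 x - u p.2 x) - w p.2 x := by
              simp only [w]
              ring
            rw [h1, h2]
            exact enorm_sub_le.trans (by gcongr; exact enorm_add_le _ _)
        _ = (∫⁻ x, ‖w p.1 x‖ₑ) + (∫⁻ x, ‖u p.1 x - u p.2 x‖ₑ) + ∫⁻ x, ‖w p.2 x‖ₑ := by
            rw [lintegral_add_right _ (hwm _).enorm, lintegral_add_left (hwm _).enorm]
        _ ≤ volume B * ENNReal.ofReal (P * ε + ε) + volume B * ENNReal.ofReal (P * ε + ε) +
              volume B * ENNReal.ofReal (P * ε + ε) := by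
            gcongr
            exacts [hw _, hw _]
        _ = volume B * (3 * ENNReal.ofReal (P * ε + ε)) := by ring
    exact (ENNReal.mul_le_mul_iff_right hB0 hBv).1 hsum
  rw [ENNReal.tendsto_nhds_zero]
  intro δ hδ
  have hsmall : Tendsto (fun ε : ℝ ↦ 3 * ENNReal.ofReal (P * ε + ε)) (𝓝[>] 0) (𝓝 0) := by
    have h1 : Tendsto (fun ε : ℝ ↦ P * ε + ε) (𝓝[>] 0) (𝓝 0) := by
      have : Continuous fun ε : ℝ ↦ P * ε + ε := by fun_prop
      simpa using (this.tendsto 0).mono_left nhdsWithin_le_nhds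
    simpa using ENNReal.Tendsto.const_mul (ENNReal.tendsto_ofReal h1)
      (Or.inr (by norm_num : (3 : ℝ≥0∞) ≠ ∞))
  obtain ⟨ε, hε, hε0⟩ := ((hsmall.eventually_le_const hδ).and self_mem_nhdsWithin).exists
  exact (hest ε hε0).mono fun p hp ↦ hp.trans hε

/-- Weak sequential compactness for subsets of a set of finite measure. -/
theorem exists_subseq_tendsto_measureReal_inter {E : ℕ → Set (EuclideanSpace ℝ (Fin n))}
    (hEm : ∀ k, MeasurableSet (E k)) {K : Set (EuclideanSpace ℝ (Fin n))} (hK : volume K ≠ ∞)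
    (hEK : ∀ k, E k ⊆ K) :
    ∃ θ : ℕ → ℕ, StrictMono θ ∧ ∀ s, MeasurableSet s → volume s ≠ ∞ →
      ∃ c : ℝ, Tendsto (fun k ↦ volume.real (E (θ k) ∩ s)) atTop (𝓝 c) := by
  have hEv : ∀ k, volume (E k) ≠ ∞ := fun k ↦ measure_ne_top_of_subset (hEK k) hK
  have : Fact ((2 : ℝ≥0∞) ≠ ∞) := ⟨by norm_num⟩
  let v : ℕ → Lp ℝ 2 (volume : Measure (EuclideanSpace ℝ (Fin n))) :=
    fun k ↦ indicatorConstLp 2 (hEm k) (hEv k) (1 : ℝ)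
  let L : ℕ → WeakDual ℝ (Lp ℝ 2 (volume : Measure (EuclideanSpace ℝ (Fin n)))) :=
    fun k ↦ StrongDual.toWeakDual (innerSL ℝ (v k))
  have hL : ∀ k, L k ∈ WeakDual.toStrongDual ⁻¹'
      Metric.closedBall (0 : StrongDual ℝ (Lp ℝ 2 (volume : Measure (EuclideanSpace ℝ (Fin n)))))
        (volume.real K ^ (1 / (2 : ℝ≥0∞).toReal)) := by
    intro k
    have h1 : ‖v k‖ ≤ volume.real K ^ (1 / (2 : ℝ≥0∞).toReal) := by
      rw [norm_indicatorConstLp (by norm_num) (by norm_num), norm_one, one_mul]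
      exact Real.rpow_le_rpow measureReal_nonneg (measureReal_mono (hEK k) hK) (by positivity)
    rw [Set.mem_preimage, mem_closedBall_zero_iff]
    exact (innerSL_apply_norm ℝ (v k)).trans_le h1
  obtain ⟨f, -, θ, hθ, hlim⟩ := WeakDual.isSeqCompact_closedBall ℝ _ _ _ hL
  refine ⟨θ, hθ, fun s hs hsv ↦ ⟨f (indicatorConstLp 2 hs hsv (1 : ℝ)), ?_⟩⟩
  refine (((WeakDual.eval_continuous (𝕜 := ℝ)
    (indicatorConstLp 2 hs hsv (1 : ℝ))).tendsto f).comp hlim).congr fun k ↦ ?_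
  exact L2.real_inner_indicatorConstLp_one_indicatorConstLp_one (hEm (θ k)) hs (hEv (θ k)) hsv

/-- Compactness for sets of uniformly bounded perimeter inside a bounded set. -/
theorem exists_subseq_ae_eventually_mem_iff {E : ℕ → Set (EuclideanSpace ℝ (Fin n))} {P : ℝ}
    (hP : 0 ≤ P) (hE : ∀ k, per (E k) ≤ ENNReal.ofReal P) (hEm : ∀ k, MeasurableSet (E k))
    {K : Set (EuclideanSpace ℝ (Fin n))} (hK : Bornology.IsBounded K) (hEK : ∀ k, E k ⊆ K) :
    ∃ (θ : ℕ → ℕ) (F : Set (EuclideanSpace ℝ (Fin n))), StrictMono θ ∧ MeasurableSet F ∧ F ⊆ K ∧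
      ∀ᵐ x, ∀ᶠ k in atTop, x ∈ E (θ k) ↔ x ∈ F := by
  obtain ⟨θ₁, hθ₁, hlim⟩ :=
    exists_subseq_tendsto_measureReal_inter hEm hK.measure_lt_top.ne hEK
  have hcauchy := tendsto_volume_symmDiff hP (fun k ↦ hE (θ₁ k)) (fun k ↦ hEm (θ₁ k)) hK
    (fun k ↦ hEK (θ₁ k)) fun x ε ↦ hlim _ measurableSet_ball measure_ball_lt_top.ne
  have hN : ∀ j : ℕ, ∃ N, ∀ k ≥ N, ∀ l ≥ N,
      volume (symmDiff (E (θ₁ k)) (E (θ₁ l))) ≤ (2 : ℝ≥0∞)⁻¹ ^ j := by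
    intro j
    have hev := hcauchy.eventually_le_const
      (show 0 < (2 : ℝ≥0∞)⁻¹ ^ j from ENNReal.pow_pos (by simp) j)
    obtain ⟨N, hN⟩ := eventually_atTop_prod_self.1 hev
    exact ⟨N, fun k hk l hl ↦ hN k l hk hl⟩
  obtain ⟨θ₂, hθ₂, hθ₂N⟩ := extraction_forall_of_eventually' fun j ↦
    (hN j).imp fun N hN k (hk : k ≥ N) ↦ (fun l (hl : l ≥ k) ↦ hN k hk l (hk.trans hl))
  let D : ℕ → Set (EuclideanSpace ℝ (Fin n)) := fun k ↦ E (θ₁ (θ₂ k))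
  have hD : ∀ k, volume (symmDiff (D k) (D (k + 1))) ≤ (2 : ℝ≥0∞)⁻¹ ^ k :=
    fun k ↦ hθ₂N k _ (hθ₂ k.lt_succ_self).le
  have hsum : ∑' k, volume (symmDiff (D k) (D (k + 1))) ≠ ∞ := by
    refine ne_top_of_le_ne_top ?_ (ENNReal.tsum_le_tsum hD)
    rw [ENNReal.tsum_geometric, ENNReal.one_sub_inv_two, inv_inv]
    norm_num
  refine ⟨θ₁ ∘ θ₂, {x | ∀ᶠ k in atTop, x ∈ D k}, hθ₁.comp hθ₂, ?_, ?_, ?_⟩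
  · have : {x | ∀ᶠ k in atTop, x ∈ D k} = ⋃ N, ⋂ k, ⋂ (_ : k ≥ N), D k := by
      ext x
      simp [eventually_atTop]
    rw [this]
    exact .iUnion fun N ↦ .iInter fun k ↦ .iInter fun _ ↦ hEm _
  · intro x hx
    obtain ⟨k, hk⟩ := hx.exists
    exact hEK _ hk
  · filter_upwards [ae_eventually_notMem hsum] with x hx
    obtain ⟨N, hN⟩ := eventually_atTop.1 hx
    have hconst : ∀ k ≥ N, x ∈ D k ↔ x ∈ D N := by
      intro k hk
      induction k, hk using Nat.le_induction with
      | base => rfl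
      | succ k hk ih =>
        have := hN k hk
        rw [Set.mem_symmDiff] at this
        tauto
    refine eventually_atTop.2 ⟨N, fun k hk ↦ ?_⟩
    refine (hconst k hk).trans ⟨fun h ↦ ?_, fun h ↦ ?_⟩
    · exact eventually_atTop.2 ⟨N, fun l hl ↦ (hconst l hl).2 h⟩
    · obtain ⟨l, hl, hlN⟩ := (h.and (eventually_ge_atTop N)).exists
      exact (hconst l hlN).1 hl

theorem tendsto_setIntegral_of_ae_eventually_mem_iff
    {E : ℕ → Set (EuclideanSpace ℝ (Fin n))} {F : Set (EuclideanSpace ℝ (Fin n))}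
    (hEm : ∀ k, MeasurableSet (E k)) (hFm : MeasurableSet F)
    (hEF : ∀ᵐ x, ∀ᶠ k in atTop, x ∈ E k ↔ x ∈ F) {f : EuclideanSpace ℝ (Fin n) → ℝ}
    (hf : Integrable f) :
    Tendsto (fun k ↦ ∫ x in E k, f x) atTop (𝓝 (∫ x in F, f x)) := by
  simp_rw [← integral_indicator (hEm _), ← integral_indicator hFm]
  refine tendsto_integral_of_dominated_convergence (fun x ↦ ‖f x‖)
    (fun k ↦ hf.aestronglyMeasurable.indicator (hEm k)) hf.norm
    (fun k ↦ .of_forall fun x ↦ norm_indicator_le_norm_self _ _) ?_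
  filter_upwards [hEF] with x hx
  refine tendsto_const_nhds.congr' ?_
  filter_upwards [hx] with k hk
  by_cases h : x ∈ F
  · rw [Set.indicator_of_mem h, Set.indicator_of_mem (hk.2 h)]
  · rw [Set.indicator_of_notMem h, Set.indicator_of_notMem fun h' ↦ h (hk.1 h')]

/-- Lower semicontinuity of the perimeter along almost everywhere convergent sequences. -/
theorem per_le_of_tendsto
    {E : ℕ → Set (EuclideanSpace ℝ (Fin n))} {F : Set (EuclideanSpace ℝ (Fin n))}
    (hEm : ∀ k, MeasurableSet (E k)) (hFm : MeasurableSet F)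
    (hEF : ∀ᵐ x, ∀ᶠ k in atTop, x ∈ E k ↔ x ∈ F) {m : ℝ≥0∞}
    (hm : Tendsto (fun k ↦ per (E k)) atTop (𝓝 m)) : per F ≤ m := by
  refine iSup_le fun φ ↦ ?_
  have hcont : Continuous (vecDiv φ.1) := by
    have h := φ.2.1.continuous_fderiv one_ne_zero
    unfold vecDiv
    fun_prop
  have hsupp : HasCompactSupport (vecDiv φ.1) := by
    refine (φ.2.2.1.fderiv (𝕜 := ℝ)).mono fun x hx ↦ ?_
    contrapose! hx
    simp only [Function.mem_support, not_not] at hx ⊢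
    simp [vecDiv, hx]
  have h := tendsto_setIntegral_of_ae_eventually_mem_iff hEm hFm hEF
    (hcont.integrable_of_hasCompactSupport hsupp)
  exact le_of_tendsto_of_tendsto' (ENNReal.tendsto_ofReal h) hm fun k ↦
    le_iSup (fun φ : {φ : EuclideanSpace ℝ (Fin n) → EuclideanSpace ℝ (Fin n) //
      ContDiff ℝ 1 φ ∧ HasCompactSupport φ ∧ tsupport φ ⊆ Set.univ ∧ ∀ x, ‖φ x‖ ≤ 1} ↦
    ENNReal.ofReal (∫ x in E k, vecDiv φ.1 x)) φ

theorem volume_eq_of_ae_eventually_mem_iff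
    {E : ℕ → Set (EuclideanSpace ℝ (Fin n))} {F : Set (EuclideanSpace ℝ (Fin n))}
    (hEm : ∀ k, MeasurableSet (E k)) (hFm : MeasurableSet F)
    (hEF : ∀ᵐ x, ∀ᶠ k in atTop, x ∈ E k ↔ x ∈ F)
    {K : Set (EuclideanSpace ℝ (Fin n))} (hKm : MeasurableSet K) (hK : volume K ≠ ∞)
    (hEK : ∀ k, E k ⊆ K) (hFK : F ⊆ K) {A : ℝ≥0∞} (hA : ∀ k, volume (E k) = A) :
    volume F = A := by
  have h := tendsto_setIntegral_of_ae_eventually_mem_iff hEm hFm hEF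
    ((integrable_indicator_iff hKm).2 (integrableOn_const (C := (1 : ℝ)) hK))
  have hreal : ∀ s, MeasurableSet s → s ⊆ K →
      ∫ x in s, K.indicator (fun _ ↦ (1 : ℝ)) x = volume.real s := by
    intro s hs hsK
    rw [setIntegral_congr_fun hs fun x hx ↦ Set.indicator_of_mem (hsK hx) _]
    simp
  rw [hreal F hFm hFK] at h
  have h' := tendsto_nhds_unique h
    (tendsto_const_nhds.congr fun k ↦ ((hreal (E k) (hEm k) (hEK k)).trans
      (congrArg ENNReal.toReal (hA k))).symm)
  exact (ENNReal.toReal_eq_toReal_iff' (measure_ne_top_of_subset hFK hK)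
    (hA 0 ▸ measure_ne_top_of_subset (hEK 0) hK)).1 h'

/-- A measurable set contains subsets of every smaller volume. -/
theorem exists_subset_volume_eq [NeZero n] {G : Set (EuclideanSpace ℝ (Fin n))}
    (hG : MeasurableSet G) (hGv : volume G ≠ ∞) {A : ℝ≥0∞} (hA : A < volume G) :
    ∃ E, MeasurableSet E ∧ E ⊆ G ∧ volume E = A := by
  let g : ℝ → ℝ := fun r ↦ volume.real (G ∩ Metric.ball 0 r)
  have hg : ∀ r, g r = ∫ x in G, (Metric.ball (0 : EuclideanSpace ℝ (Fin n)) r).indicator 1 x := by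
    intro r
    rw [integral_indicator_one measurableSet_ball, measureReal_restrict_apply measurableSet_ball,
      Set.inter_comm]
  have hfin : IsFiniteMeasure (volume.restrict G) := ⟨by simpa using hGv.lt_top⟩
  have hcont : Continuous g := by
    rw [continuous_iff_continuousAt]
    intro r
    simp_rw [ContinuousAt, funext hg]
    refine tendsto_integral_filter_of_dominated_convergence (fun _ ↦ (1 : ℝ))
      (.of_forall fun r ↦ (measurable_one.indicator measurableSet_ball).aestronglyMeasurable)
      (.of_forall fun r ↦ .of_forall fun x ↦ ?_) (integrable_const _) ?_
    · by_cases h : x ∈ Metric.ball (0 : EuclideanSpace ℝ (Fin n)) r <;> simp [h]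
    · have hsph : ∀ᵐ x ∂volume.restrict G, x ∉ Metric.sphere (0 : EuclideanSpace ℝ (Fin n)) r :=
        ae_restrict_of_ae (measure_eq_zero_iff_ae_notMem.1 (Measure.addHaar_sphere _ _ _))
      filter_upwards [hsph] with x hx
      refine tendsto_const_nhds.congr' ?_
      rw [mem_sphere_zero_iff_norm] at hx
      rcases lt_or_gt_of_ne hx with h | h
      · filter_upwards [eventually_gt_nhds h] with s hs
        simp [h, hs]
      · filter_upwards [eventually_lt_nhds h] with s hs
        simp [h.not_gt, hs.not_gt]
  have hAtop : A ≠ ∞ := hA.ne_top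
  have hA0 : g 0 ≤ A.toReal := by simp [g]
  have hmono : Monotone fun k : ℕ ↦ G ∩ Metric.ball (0 : EuclideanSpace ℝ (Fin n)) k :=
    fun i j hij ↦ Set.inter_subset_inter_right _ (Metric.ball_subset_ball (by exact_mod_cast hij))
  have hlim : Tendsto (fun k : ℕ ↦ volume (G ∩ Metric.ball 0 k)) atTop (𝓝 (volume G)) := by
    have := tendsto_measure_iUnion_atTop (μ := volume) hmono
    rwa [← Set.inter_iUnion, Metric.iUnion_ball_nat, Set.inter_univ] at this
  obtain ⟨k, hk⟩ := (hlim.eventually_const_lt hA).exists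
  have hfink : ∀ r : ℝ, volume (G ∩ Metric.ball 0 r) ≠ ∞ := fun r ↦
    measure_ne_top_of_subset Set.inter_subset_left hGv
  have hAk : A.toReal ≤ g k := ENNReal.toReal_mono (hfink _) hk.le
  obtain ⟨r, -, hr⟩ := intermediate_value_Icc (Nat.cast_nonneg k) hcont.continuousOn ⟨hA0, hAk⟩
  exact ⟨_, hG.inter measurableSet_ball, Set.inter_subset_left,
    (ENNReal.toReal_eq_toReal_iff' (hfink r) hAtop).1 hr⟩

end

/-- In a bounded subregion, for every `A ∈ [0, Lⁿ(G))` the constrained isoperimetric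
problem has a solution: a perimeter-minimal subset of `cl(G)` of volume `A`; in particular
the infimum defining the isoperimetric profile is attained. -/
theorem existence_perimeter_minimizer (n : ℕ) (hn : 2 ≤ n)
    (G : Set (EuclideanSpace ℝ (Fin n))) (hGopen : IsOpen G)
    (hGnull : volume (frontier G) = 0) (hGbdd : Bornology.IsBounded G)
    (A : ℝ≥0∞) (hA : A < volume G) :
    ∃ E : Set (EuclideanSpace ℝ (Fin n)), MeasurableSet E ∧ E ⊆ closure G ∧ volume E = A ∧
      ∀ E' : Set (EuclideanSpace ℝ (Fin n)), MeasurableSet E' → E' ⊆ closure G →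
        volume E' = A → per E ≤ per E' := by
  have : NeZero n := ⟨by omega⟩
  have hKb : Bornology.IsBounded (closure G) := hGbdd.closure
  have hKv : volume (closure G) ≠ ∞ := hKb.measure_lt_top.ne
  let S : Set (Set (EuclideanSpace ℝ (Fin n))) :=
    {E | MeasurableSet E ∧ E ⊆ closure G ∧ volume E = A}
  obtain ⟨E₀, hE₀m, hE₀G, hE₀A⟩ :=
    exists_subset_volume_eq hGopen.measurableSet hGbdd.measure_lt_top.ne hA
  have hE₀ : E₀ ∈ S := ⟨hE₀m, hE₀G.trans subset_closure, hE₀A⟩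
  rcases eq_or_ne (sInf (per '' S)) ∞ with htop | hfin
  · refine ⟨E₀, hE₀.1, hE₀.2.1, hE₀.2.2, fun E' h1 h2 h3 ↦ ?_⟩
    have : per E' = ∞ := sInf_eq_top.1 htop _ ⟨E', ⟨h1, h2, h3⟩, rfl⟩
    rw [this]
    exact le_top
  obtain ⟨u, -, hulim, hu⟩ := exists_seq_tendsto_sInf (Set.Nonempty.image per ⟨E₀, hE₀⟩)
    (OrderBot.bddBelow _)
  choose D hDS hDu using hu
  have hlim : Tendsto (fun k ↦ per (D k)) atTop (𝓝 (sInf (per '' S))) := by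
    simpa only [hDu] using hulim
  obtain ⟨N, hN⟩ := eventually_atTop.1
    (hlim.eventually_le_const (ENNReal.lt_add_right hfin one_ne_zero))
  have hP : sInf (per '' S) + 1 ≠ ∞ := ENNReal.add_ne_top.2 ⟨hfin, ENNReal.one_ne_top⟩
  obtain ⟨θ, F, hθ, hFm, hFK, hae⟩ := exists_subseq_ae_eventually_mem_iff
    (E := fun k ↦ D (k + N)) ENNReal.toReal_nonneg
    (fun k ↦ (hN (k + N) (Nat.le_add_left N k)).trans_eq (ENNReal.ofReal_toReal hP).symm)
    (fun k ↦ (hDS (k + N)).1) hKb (fun k ↦ (hDS (k + N)).2.1)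
  have hFper : per F ≤ sInf (per '' S) :=
    per_le_of_tendsto (fun k ↦ (hDS (θ k + N)).1) hFm hae
      (hlim.comp ((tendsto_add_atTop_nat N).comp hθ.tendsto_atTop))
  refine ⟨F, hFm, hFK, ?_, fun E' h1 h2 h3 ↦ hFper.trans (sInf_le ⟨E', ⟨h1, h2, h3⟩, rfl⟩)⟩
  exact volume_eq_of_ae_eventually_mem_iff (fun k ↦ (hDS (θ k + N)).1) hFm hae
    isClosed_closure.measurableSet hKv (fun k ↦ (hDS (θ k + N)).2.1) hFK
    fun k ↦ (hDS (θ k + N)).2.2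
end
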